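/- arXiv:2402.02531 — 3 statements merged into one kernel-verified Lean document; each statement's English description precedes it below -/
import Mathlib

section
/- Ellipsoid lemma for the degenerate parabolic operator: Suppose v is of class C^{2,1} on (0,d0) × (0,T], is continuous on [0,d0] × [0,T], and satisfies (Lv)(x,t) ≤ 0 for all (x,t) ∈ (0,d0) × (0,T]. Let M0 ∈ ℝ be such that v(x,t) ≤ M0 for all (x,t) ∈ (0,d0) × (0,T]. Let σ > 0, r > 0 and (x*, t*) ∈ ℝ² be such that the closed solid ellipsoid E := {(x,t) : (x−x*)² + σ(t−t*)² ≤ r²} is contained in (0,d0) × (0,T], v(x,t) < M0 for every interior point (x,t) of E, and v(x̄, t̄) = M0 for some point (x̄, t̄) with (x̄−x*)² + σ(t̄−t*)² = r². Then x̄ = x*. -/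
open Set

/-- Second-order necessary condition: at a local maximum the second derivative is nonpositive. -/
theorem IsLocalMax.second_hasDerivAt_nonpos {f f' : ℝ → ℝ} {c x : ℝ} (hmax : IsLocalMax f x)
    (hf : ∀ᶠ y in nhds x, HasDerivAt f (f' y) y) (hf' : HasDerivAt f' c x) : c ≤ 0 := by
  have hderiv : deriv f =ᶠ[nhds x] f' := hf.mono fun y hy => hy.deriv
  have hc : deriv (deriv f) x = c := hderiv.deriv_eq.trans hf'.deriv
  by_contra! hpos
  have hmin : IsLocalMin f x :=
    isLocalMin_of_deriv_deriv_pos (by rwa [hc]) hmax.deriv_eq_zero hf.self_of_nhds.continuousAt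
  have hconst : f =ᶠ[nhds x] fun _ => f x :=
    (hmax.and hmin).mono fun y hy => le_antisymm hy.1 hy.2
  have hzero : deriv (deriv f) x = 0 := by
    rw [hconst.deriv.deriv_eq]
    simp
  linarith

/-- The value of the parabolic operator on the Gaussian barrier is negative. -/
theorem parabolic_barrier_neg {B m σ R X κ α n a b y s e : ℝ}
    (hB : 0 < B) (hσ : 0 < σ) (hα : 0 < α) (he : 0 < e)
    (hn : 0 ≤ n) (hnm : n ≤ m) (ha : 1 / (2 * B) ≤ a) (haB : a ≤ 2 * B)
    (hb : |b| ≤ 8 * B * (m + 1)) (hs : |s| < R) (hy : |y| < X) (hyκ : κ < y ^ 2)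
    (hακ : B * (m * σ * R + 2 * B + 8 * B * (m + 1) * X + 1) = α * κ) :
    n * (e * (-2 * α * σ * s)) - a * (e * (4 * α ^ 2 * y ^ 2 - 2 * α)) -
      b * (e * (-2 * α * y)) < 0 := by
  have hm : 0 ≤ m := hn.trans hnm
  have hns : -(n * s) ≤ m * R := by
    calc -(n * s) ≤ |n * s| := neg_le_abs _
      _ = n * |s| := by rw [abs_mul, abs_of_nonneg hn]
      _ ≤ m * R := mul_le_mul hnm hs.le (abs_nonneg _) hm
  have hby : b * y ≤ 8 * B * (m + 1) * X := by
    calc b * y ≤ |b * y| := le_abs_self _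
      _ = |b| * |y| := abs_mul _ _
      _ ≤ 8 * B * (m + 1) * X := mul_le_mul hb hy.le (abs_nonneg _) (by positivity)
  have hay : m * σ * R + 2 * B + 8 * B * (m + 1) * X + 1 ≤ 2 * a * α * y ^ 2 := by
    have h1 : 1 ≤ 2 * a * B := by
      have := mul_le_mul_of_nonneg_right ha (by positivity : 0 ≤ 2 * B)
      rw [one_div, inv_mul_cancel₀ (by positivity)] at this
      linarith
    have h2 : α * κ ≤ B * (2 * a * α * y ^ 2) := by
      calc α * κ ≤ α * y ^ 2 := by gcongr
        _ ≤ (2 * a * B) * (α * y ^ 2) := le_mul_of_one_le_left (by positivity) h1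
        _ = B * (2 * a * α * y ^ 2) := by ring
    rw [← hακ] at h2
    exact le_of_mul_le_mul_left h2 hB
  have hσs := mul_le_mul_of_nonneg_left hns hσ.le
  have hneg : -(n * s) * σ - 2 * a * α * y ^ 2 + a + b * y < 0 := by linarith
  calc _ = (2 * α * e) * (-(n * s) * σ - 2 * a * α * y ^ 2 + a + b * y) := by ring
    _ < 0 := mul_neg_of_pos_of_neg (by positivity) hneg

/-- Ellipsoid lemma for the degenerate parabolic operator
    `(Lv)(x,t) = n0(x) vₜ - a(x,t) vₓₓ - b(x,t) vₓ`: if `Lv ≤ 0` on `(0,d0) × (0,T]`,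
    `v ≤ M0` there, and the closed solid ellipsoid
    `E = {(x,t) : (x-x*)² + σ(t-t*)² ≤ r²}` is contained in `(0,d0) × (0,T]` with
    `v < M0` in its interior and `v(x̄,t̄) = M0` at a boundary point of `E`,
    then `x̄ = x*`. -/
theorem ellipsoid_lemma_degenerate_parabolic
    (B m d0 T : ℝ)
    (hB : 0 < B) (hm : 0 < m) (hd0 : d0 ∈ Set.Ioo (0:ℝ) 1) (hT : 0 < T)
    (n0 : ℝ → ℝ) (hn0cont : Continuous n0)
    (hn0 : ∀ x ∈ Set.Icc (0:ℝ) d0, 0 ≤ n0 x ∧ n0 x ≤ m)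
    (a b : ℝ → ℝ → ℝ)
    (hacont : ContinuousOn (fun p : ℝ × ℝ => a p.1 p.2) (Set.Icc 0 d0 ×ˢ Set.Icc 0 T))
    (hbcont : ContinuousOn (fun p : ℝ × ℝ => b p.1 p.2) (Set.Icc 0 d0 ×ˢ Set.Icc 0 T))
    (ha : ∀ x ∈ Set.Icc (0:ℝ) d0, ∀ t ∈ Set.Icc (0:ℝ) T,
      1/(2*B) ≤ a x t ∧ a x t ≤ 2*B)
    (hb : ∀ x ∈ Set.Icc (0:ℝ) d0, ∀ t ∈ Set.Icc (0:ℝ) T, |b x t| ≤ 8*B*(m+1))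
    (v vx vxx vt : ℝ → ℝ → ℝ)
    (hvx : ∀ x ∈ Set.Ioo (0:ℝ) d0, ∀ t ∈ Set.Ioc (0:ℝ) T,
      HasDerivAt (fun y => v y t) (vx x t) x)
    (hvxx : ∀ x ∈ Set.Ioo (0:ℝ) d0, ∀ t ∈ Set.Ioc (0:ℝ) T,
      HasDerivAt (fun y => vx y t) (vxx x t) x)
    (hvt : ∀ x ∈ Set.Ioo (0:ℝ) d0, ∀ t ∈ Set.Ioc (0:ℝ) T,
      HasDerivWithinAt (fun s => v x s) (vt x t) (Set.Iic T) t)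
    (hvxcont : ContinuousOn (fun p : ℝ × ℝ => vx p.1 p.2) (Set.Ioo 0 d0 ×ˢ Set.Ioc 0 T))
    (hvxxcont : ContinuousOn (fun p : ℝ × ℝ => vxx p.1 p.2) (Set.Ioo 0 d0 ×ˢ Set.Ioc 0 T))
    (hvtcont : ContinuousOn (fun p : ℝ × ℝ => vt p.1 p.2) (Set.Ioo 0 d0 ×ˢ Set.Ioc 0 T))
    (hvcont : ContinuousOn (fun p : ℝ × ℝ => v p.1 p.2) (Set.Icc 0 d0 ×ˢ Set.Icc 0 T))
    (hLv : ∀ x ∈ Set.Ioo (0:ℝ) d0, ∀ t ∈ Set.Ioc (0:ℝ) T,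
      n0 x * vt x t - a x t * vxx x t - b x t * vx x t ≤ 0)
    (M0 : ℝ) (hM0 : ∀ x ∈ Set.Ioo (0:ℝ) d0, ∀ t ∈ Set.Ioc (0:ℝ) T, v x t ≤ M0)
    (σ r xs ts : ℝ) (hσ : 0 < σ) (hr : 0 < r)
    (hE : {p : ℝ × ℝ | (p.1-xs)^2 + σ*(p.2-ts)^2 ≤ r^2} ⊆ Set.Ioo 0 d0 ×ˢ Set.Ioc 0 T)
    (hint : ∀ x t : ℝ, (x-xs)^2 + σ*(t-ts)^2 < r^2 → v x t < M0)
    (xb tb : ℝ) (hbdry : (xb-xs)^2 + σ*(tb-ts)^2 = r^2) (hvb : v xb tb = M0) :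
    xb = xs := by
  by_contra hne
  -- An internally tangent ellipsoid meets the boundary of the original one only at `(xb, tb)`.
  obtain ⟨c, hc⟩ : ∃ c, c = (xs + xb) / 2 := ⟨_, rfl⟩
  obtain ⟨d, hd⟩ : ∃ d, d = (ts + tb) / 2 := ⟨_, rfl⟩
  have hv_lt : ∀ x t : ℝ, (x - c) ^ 2 + σ * (t - d) ^ 2 ≤ r ^ 2 / 4 → (x, t) ≠ (xb, tb) →
      v x t < M0 := by
    intro x t hxt hp
    apply hint
    have hpos : 0 < (x - xb) ^ 2 + σ * (t - tb) ^ 2 := by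
      by_cases hx : x = xb
      · have ht : t - tb ≠ 0 := fun h => hp (by rw [hx, sub_eq_zero.1 h])
        positivity
      · have := sub_ne_zero.2 hx
        positivity
    subst hc hd
    linarith
  have hbc : (xb - c) ^ 2 + σ * (tb - d) ^ 2 = r ^ 2 / 4 := by
    subst hc hd
    linarith
  have hκ : 0 < (xb - c) ^ 2 := by
    have : xb - c ≠ 0 := fun h => hne (by linarith)
    positivity
  have hmem : ∀ x t : ℝ, (x - xs) ^ 2 + σ * (t - ts) ^ 2 ≤ r ^ 2 → x ∈ Ioo 0 d0 ∧ t ∈ Ioc 0 T :=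
    fun x t h => hE (show (x, t) ∈ {p : ℝ × ℝ | _} from h)
  obtain ⟨hxb, htb⟩ := hmem xb tb hbdry.le
  have htbT : tb < T := by
    have htop := (hmem xs (ts + r / √σ) (by
      rw [sub_self, add_sub_cancel_left, div_pow, Real.sq_sqrt hσ.le]
      field_simp
      simp)).2.2
    have hlt : tb - ts < r / √σ := by
      apply lt_of_pow_lt_pow_left₀ 2 (by positivity)
      rw [div_pow, Real.sq_sqrt hσ.le, lt_div_iff₀ hσ]
      have := sub_ne_zero.2 hne
      have : 0 < (xb - xs) ^ 2 := by positivity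
      linarith
    linarith
  -- A neighbourhood of `(xb, tb)` on which the barrier is a strict subsolution.
  obtain ⟨δ, hδ, hball⟩ : ∃ δ > 0, Metric.closedBall (xb, tb) δ ⊆
      {p : ℝ × ℝ | (p.1 ∈ Ioo 0 d0 ∧ p.2 ∈ Ioo 0 T) ∧
        ((xb - c) ^ 2 / 2 < (p.1 - c) ^ 2 ∧ |p.1 - c| < |xb - c| + 1) ∧
        |p.2 - d| < |tb - d| + 1} := by
    rw [← Metric.nhds_basis_closedBall.mem_iff]
    apply IsOpen.mem_nhds
    · refine ((isOpen_Ioo.preimage continuous_fst).and (isOpen_Ioo.preimage continuous_snd)).and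
        (((isOpen_lt ?_ ?_).and (isOpen_lt ?_ ?_)).and (isOpen_lt ?_ ?_)) <;> fun_prop
    · exact ⟨⟨hxb, htb.1, htbT⟩, ⟨half_lt_self hκ, lt_add_one _⟩, lt_add_one _⟩
  have hvD : ContinuousOn (fun p : ℝ × ℝ => v p.1 p.2) (Metric.closedBall (xb, tb) δ) :=
    hvcont.mono fun p hp =>
      ⟨Ioo_subset_Icc_self (hball hp).1.1, Ioo_subset_Icc_self (hball hp).1.2⟩
  obtain ⟨α, hα⟩ : ∃ α, α = B * (m * σ * (|tb - d| + 1) + 2 * B + 8 * B * (m + 1) *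
      (|xb - c| + 1) + 1) / ((xb - c) ^ 2 / 2) := ⟨_, rfl⟩
  have hαpos : 0 < α := by rw [hα]; positivity
  obtain ⟨g, hg⟩ : ∃ g : ℝ → ℝ → ℝ,
      g = fun x t => Real.exp (-α * ((x - c) ^ 2 + σ * (t - d) ^ 2)) := ⟨_, rfl⟩
  have hgcont : Continuous fun p : ℝ × ℝ => g p.1 p.2 := by
    rw [hg]
    fun_prop
  have hgpos : ∀ x t, 0 < g x t := fun x t => by rw [hg]; exact Real.exp_pos _
  have hg_le_one : ∀ x t, g x t ≤ 1 := fun x t => by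
    rw [hg]
    apply Real.exp_le_one_iff.2
    rw [neg_mul]
    exact neg_nonpos.2 (by positivity)
  have hg_lt : ∀ x t, r ^ 2 / 4 < (x - c) ^ 2 + σ * (t - d) ^ 2 → g x t < g xb tb := by
    intro x t h
    simp only [hg, hbc]
    exact Real.exp_lt_exp.2 (mul_lt_mul_of_neg_left h (neg_lt_zero.2 hαpos))
  have hgx : ∀ x t, HasDerivAt (fun y => g y t) (g x t * (-2 * α * (x - c))) x := by
    intro x t
    simp only [hg]
    exact (((((hasDerivAt_id x).sub_const c).pow 2).add_const (σ * (t - d) ^ 2)).const_mul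
      (-α)).exp.congr_deriv (by simp; ring)
  have hgxx : ∀ x t, HasDerivAt (fun y => g y t * (-2 * α * (y - c)))
      (g x t * (4 * α ^ 2 * (x - c) ^ 2 - 2 * α)) x := by
    intro x t
    exact ((hgx x t).mul (((hasDerivAt_id x).sub_const c).const_mul (-2 * α))).congr_deriv
      (by simp only [id]; ring)
  have hgt : ∀ x t, HasDerivAt (fun s => g x s) (g x t * (-2 * α * σ * (t - d))) t := by
    intro x t
    simp only [hg]
    exact (((((hasDerivAt_id t).sub_const d).pow 2).const_mul σ).const_add ((x - c) ^ 2)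
      |>.const_mul (-α)).exp.congr_deriv (by simp; ring)
  -- `v` stays uniformly below `M0` on the part of the boundary inside the tangent ellipsoid.
  obtain ⟨ε, hε, hvε⟩ : ∃ ε > 0, ∀ p ∈ Metric.sphere (xb, tb) δ,
      (p.1 - c) ^ 2 + σ * (p.2 - d) ^ 2 ≤ r ^ 2 / 4 → v p.1 p.2 + ε < M0 := by
    have hK : IsCompact (Metric.sphere (xb, tb) δ ∩
        {p : ℝ × ℝ | (p.1 - c) ^ 2 + σ * (p.2 - d) ^ 2 ≤ r ^ 2 / 4}) :=
      (isCompact_sphere _ _).inter_right (isClosed_le (by fun_prop) (by fun_prop))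
    rcases Set.eq_empty_or_nonempty (Metric.sphere (xb, tb) δ ∩
        {p : ℝ × ℝ | (p.1 - c) ^ 2 + σ * (p.2 - d) ^ 2 ≤ r ^ 2 / 4}) with hem | hnem
    · exact ⟨1, one_pos, fun p hp hpE => (hem.le ⟨hp, hpE⟩).elim⟩
    · obtain ⟨q, hq, hqmax⟩ := hK.exists_isMaxOn hnem
        (hvD.mono (inter_subset_left.trans Metric.sphere_subset_closedBall))
      have hqne : (q.1, q.2) ≠ (xb, tb) := Metric.ne_of_mem_sphere hq.1 hδ.ne'
      have hqlt := hv_lt q.1 q.2 hq.2 hqne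
      refine ⟨(M0 - v q.1 q.2) / 2, by linarith, fun p hp hpE => ?_⟩
      have : v p.1 p.2 ≤ v q.1 q.2 := hqmax ⟨hp, hpE⟩
      linarith
  obtain ⟨p, hpD, hpmax⟩ := (isCompact_closedBall (xb, tb) δ).exists_isMaxOn
    ⟨_, Metric.mem_closedBall_self hδ.le⟩ (hvD.add (hgcont.continuousOn.const_smul ε))
  obtain ⟨x, t⟩ := p
  have hmax : ∀ q ∈ Metric.closedBall (xb, tb) δ,
      v q.1 q.2 + ε * g q.1 q.2 ≤ v x t + ε * g x t := fun q hq => hpmax hq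
  obtain ⟨⟨hx, ht⟩, ⟨hyκ, hyX⟩, hsR⟩ := hball hpD
  dsimp only at hx ht hyκ hyX hsR
  have hpball : (x, t) ∈ Metric.ball (xb, tb) δ := by
    by_contra hnot
    have hsph : (x, t) ∈ Metric.sphere (xb, tb) δ :=
      le_antisymm hpD (not_lt.1 hnot)
    have hge := hmax _ (Metric.mem_closedBall_self hδ.le)
    dsimp only at hge
    rw [hvb] at hge
    rcases le_or_gt ((x - c) ^ 2 + σ * (t - d) ^ 2) (r ^ 2 / 4) with hin | hout
    · have h1 := hvε _ hsph hin
      have h2 := mul_le_mul_of_nonneg_left (hg_le_one x t) hε.le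
      have h3 := mul_pos hε (hgpos xb tb)
      dsimp only at h1
      linarith
    · have h1 := hM0 x hx t ⟨ht.1, ht.2.le⟩
      have h2 := mul_lt_mul_of_pos_left (hg_lt x t hout) hε
      linarith
  have hlocmax : IsLocalMax (fun q : ℝ × ℝ => v q.1 q.2 + ε * g q.1 q.2) (x, t) :=
    Filter.mem_of_superset (Metric.isOpen_ball.mem_nhds hpball)
      fun q hq => hmax q (Metric.ball_subset_closedBall hq)
  have ht' : t ∈ Ioc 0 T := ⟨ht.1, ht.2.le⟩
  have hmaxx : IsLocalMax (fun y => v y t + ε * g y t) x :=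
    (Continuous.prodMk_left t).continuousAt.eventually hlocmax
  have hmaxt : IsLocalMax (fun s => v x s + ε * g x s) t :=
    (Continuous.prodMk_right x).continuousAt.eventually hlocmax
  have hdx : ∀ y ∈ Ioo 0 d0, HasDerivAt (fun y => v y t + ε * g y t)
      (vx y t + ε * (g y t * (-2 * α * (y - c)))) y :=
    fun y hy => (hvx y hy t ht').add ((hgx y t).const_mul ε)
  have hx0 := hmaxx.hasDerivAt_eq_zero (hdx x hx)
  have ht0 := hmaxt.hasDerivAt_eq_zero
    (((hvt x hx t ht').hasDerivAt (Iic_mem_nhds ht.2)).add ((hgt x t).const_mul ε))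
  have hxx0 := hmaxx.second_hasDerivAt_nonpos
    (Filter.mem_of_superset (isOpen_Ioo.mem_nhds hx) hdx)
    ((hvxx x hx t ht').add ((hgxx x t).const_mul ε))
  have hxI := Ioo_subset_Icc_self hx
  have htI := Ioo_subset_Icc_self ht
  obtain ⟨ha1, ha2⟩ := ha x hxI t htI
  have hLg := parabolic_barrier_neg hB hσ hαpos (hgpos x t) (hn0 x hxI).1 (hn0 x hxI).2 ha1 ha2
    (hb x hxI t htI) hsR hyX hyκ (by rw [hα, div_mul_cancel₀ _ (half_pos hκ).ne'])
  have ha0 : 0 ≤ a x t := le_trans (by positivity) ha1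
  have hL := hLv x hx t ht'
  rw [eq_neg_of_add_eq_zero_left hx0, eq_neg_of_add_eq_zero_left ht0] at hL
  have h1 := mul_nonpos_of_nonneg_of_nonpos ha0 hxx0
  have h2 := mul_neg_of_pos_of_neg hε hLg
  linarith
end

section
/- Propagation of an interior maximum along a time slice: Suppose v is of class C^{2,1} on (0,d0) × (0,T], is continuous on [0,d0] × [0,T], and satisfies (Lv)(x,t) ≤ 0 for all (x,t) ∈ (0,d0) × (0,T]. If v attains its maximum over [0,d0] × [0,T] at an interior point (x0,t0) ∈ (0,d0) × (0,T], then v(x,t0) = v(x0,t0) for every x ∈ (0,d0). -/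
open Set Filter Topology

lemma HasDerivWithinAt.nonneg_of_eventually_le_left {f : ℝ → ℝ} {f' t : ℝ}
    (hf : HasDerivWithinAt f f' (Iic t) t) (hmax : ∀ᶠ s in 𝓝[<] t, f s ≤ f t) : 0 ≤ f' := by
  have hslope := (hasDerivWithinAt_iff_tendsto_slope' (s := Iio t) (by simp)).1
    (hf.mono Iio_subset_Iic_self)
  refine ge_of_tendsto hslope ?_
  filter_upwards [hmax, self_mem_nhdsWithin] with s hs hst
  rw [slope_def_field]
  exact div_nonneg_of_nonpos (by linarith) (by linarith [mem_Iio.1 hst])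

lemma IsLocalMax.second_deriv_nonpos {f f' : ℝ → ℝ} {f'' x : ℝ} (hmax : IsLocalMax f x)
    (hf : ∀ᶠ y in 𝓝 x, HasDerivAt f (f' y) y) (hf' : HasDerivAt f' f'' x) : f'' ≤ 0 := by
  by_contra! hpos
  have hderiv : deriv f =ᶠ[𝓝 x] f' := hf.mono fun y hy => hy.deriv
  have hdd : deriv (deriv f) x = f'' := hderiv.deriv_eq.trans hf'.deriv
  have hmin : IsLocalMin f x :=
    isLocalMin_of_deriv_deriv_pos (by rwa [hdd]) hmax.deriv_eq_zero hf.self_of_nhds.continuousAt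
  have hconst : f =ᶠ[𝓝 x] fun _ => f x := by
    filter_upwards [hmax, hmin] with y h₁ h₂ using le_antisymm h₁ h₂
  have hzero : deriv (deriv f) x = 0 := by
    rw [hconst.deriv.deriv_eq]
    simp
  linarith

/-- If a subsolution of a degenerate parabolic operator is bounded by `M` on a rectangle and lies
strictly below `M` on the left side, then at the final time it lies strictly below `M` everywhere
except possibly at the right end. -/
lemma degenerate_parabolic_lt_of_lt_left {A C m M p q t₁ t₀ : ℝ}
    (hA : 0 < A) (hC : 0 ≤ C) (hm : 0 ≤ m) (ht : t₁ < t₀)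
    {n a b v vx vxx vt : ℝ → ℝ → ℝ}
    (hn : ∀ x ∈ Ioo p q, ∀ t ∈ Ioc t₁ t₀, 0 ≤ n x t ∧ n x t ≤ m)
    (ha : ∀ x ∈ Ioo p q, ∀ t ∈ Ioc t₁ t₀, A ≤ a x t)
    (hb : ∀ x ∈ Ioo p q, ∀ t ∈ Ioc t₁ t₀, |b x t| ≤ C)
    (hvx : ∀ x ∈ Ioo p q, ∀ t ∈ Ioc t₁ t₀, HasDerivAt (fun y => v y t) (vx x t) x)
    (hvxx : ∀ x ∈ Ioo p q, ∀ t ∈ Ioc t₁ t₀, HasDerivAt (fun y => vx y t) (vxx x t) x)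
    (hvt : ∀ x ∈ Ioo p q, ∀ t ∈ Ioc t₁ t₀,
      HasDerivWithinAt (fun s => v x s) (vt x t) (Iic t) t)
    (hv : ContinuousOn (fun z : ℝ × ℝ => v z.1 z.2) (Icc p q ×ˢ Icc t₁ t₀))
    (hL : ∀ x ∈ Ioo p q, ∀ t ∈ Ioc t₁ t₀,
      n x t * vt x t - a x t * vxx x t - b x t * vx x t ≤ 0)
    (hM : ∀ x ∈ Icc p q, ∀ t ∈ Icc t₁ t₀, v x t ≤ M)
    (hleft : ∀ t ∈ Icc t₁ t₀, v p t < M) :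
    ∀ x ∈ Ico p q, v x t₀ < M := by
  intro x₀ hx₀
  have hpq : p < q := hx₀.1.trans_lt hx₀.2
  by_contra! hge
  obtain ⟨ε, hε, hεle⟩ : ∃ ε > 0, ∀ t ∈ Icc t₁ t₀, v p t + ε ≤ M := by
    have hcont : ContinuousOn (fun t => v p t) (Icc t₁ t₀) :=
      hv.comp (f := fun t : ℝ => (p, t)) (by fun_prop)
        fun t ht' => ⟨left_mem_Icc.2 hpq.le, ht'⟩
    obtain ⟨s, hs, hsmax⟩ := isCompact_Icc.exists_isMaxOn (nonempty_Icc.2 ht.le) hcont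
    exact ⟨M - v p s, by linarith [hleft s hs], fun t ht' => by
      have : v p t ≤ v p s := hsmax ht'
      linarith⟩
  obtain ⟨K, hK, hKt⟩ : ∃ K > 0, K * (t₀ - t₁) = q - p :=
    ⟨(q - p) / (t₀ - t₁), div_pos (by linarith) (by linarith),
      div_mul_cancel₀ _ (by linarith)⟩
  obtain ⟨α, hα, hαA⟩ : ∃ α > 0, m * K + C < A * α :=
    ⟨(m * K + C) / A + 1, by positivity, by field_simp; linarith⟩
  set h : ℝ → ℝ → ℝ := fun x t => Real.exp (-α * ((x - p) + K * (t₀ - t))) with h_def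
  have hhx : ∀ x t, HasDerivAt (fun y => h y t) (-α * h x t) x := fun x t => by
    have hlin : HasDerivAt (fun y : ℝ => -α * ((y - p) + K * (t₀ - t))) (-α * 1) x :=
      (((hasDerivAt_id x).sub_const p).add_const _).const_mul _
    convert hlin.exp using 1
    simp only [h_def]
    ring
  have hht : ∀ x t, HasDerivAt (fun s => h x s) (α * K * h x t) t := fun x t => by
    have hlin : HasDerivAt (fun s : ℝ => -α * ((x - p) + K * (t₀ - s))) (-α * (K * (-1))) t :=
      ((((hasDerivAt_id t).const_sub t₀).const_mul K).const_add _).const_mul _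
    convert hlin.exp using 1
    simp only [h_def]
    ring
  have hhcont : Continuous fun z : ℝ × ℝ => h z.1 z.2 := by
    simp only [h_def]
    fun_prop
  set c : ℝ := Real.exp (-α * (q - p)) with c_def
  have hc : 0 < c := Real.exp_pos _
  have hle_c : ∀ x t, q - p ≤ (x - p) + K * (t₀ - t) → h x t ≤ c := fun x t hxt =>
    Real.exp_le_exp.2 (by nlinarith)
  obtain ⟨⟨x, t⟩, ⟨hx, ht'⟩, hzmax⟩ := (isCompact_Icc.prod isCompact_Icc).exists_isMaxOn
    (⟨(p, t₀), left_mem_Icc.2 hpq.le, right_mem_Icc.2 ht.le⟩ : (Icc p q ×ˢ Icc t₁ t₀).Nonempty)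
    (hv.add (hhcont.continuousOn.const_smul ε))
  replace hx : x ∈ Icc p q := hx
  replace ht' : t ∈ Icc t₁ t₀ := ht'
  have hw : ∀ y ∈ Icc p q, ∀ s ∈ Icc t₁ t₀, v y s + ε * h y s ≤ v x t + ε * h x t :=
    fun y hy s hs => hzmax (show (y, s) ∈ Icc p q ×ˢ Icc t₁ t₀ from ⟨hy, hs⟩)
  have hgt : M + ε * c < v x t + ε * h x t := by
    have h₁ := hw x₀ ⟨hx₀.1, hx₀.2.le⟩ t₀ (right_mem_Icc.2 ht.le)
    have h₂ : c < h x₀ t₀ := Real.exp_lt_exp.2 (by nlinarith [hx₀.2])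
    nlinarith
  have hc_lt : c < h x t := by
    have := hM x hx t ht'
    nlinarith
  have hψ : (x - p) + K * (t₀ - t) < q - p := by
    by_contra! hcon
    exact hc_lt.not_ge (hle_c x t hcon)
  have hxq : x < q := by nlinarith [ht'.2]
  have htt : t₁ < t := by
    by_contra! hcon
    nlinarith [hx.1]
  have hpx : p < x := by
    refine hx.1.lt_of_ne fun heq => ?_
    subst heq
    have h₁ : h p t ≤ 1 := Real.exp_le_one_iff.2 (by
      have := mul_nonneg hK.le (sub_nonneg.2 ht'.2)
      nlinarith)
    have h₂ := hεle t ht'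
    nlinarith [mul_pos hε hc]
  have hxm : x ∈ Ioo p q := ⟨hpx, hxq⟩
  have htm : t ∈ Ioc t₁ t₀ := ⟨htt, ht'.2⟩
  have hlocmax : IsLocalMax (fun y => v y t + ε * h y t) x := by
    filter_upwards [Ioo_mem_nhds hpx hxq] with y hy using hw y (Ioo_subset_Icc_self hy) t ht'
  have hwx : ∀ y ∈ Ioo p q, HasDerivAt (fun y => v y t + ε * h y t)
      (vx y t + ε * (-α * h y t)) y :=
    fun y hy => (hvx y hy t htm).add ((hhx y t).const_mul ε)
  have hwx_zero : vx x t + ε * (-α * h x t) = 0 := hlocmax.hasDerivAt_eq_zero (hwx x hxm)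
  have hwxx : vxx x t + ε * (-α * (-α * h x t)) ≤ 0 :=
    hlocmax.second_deriv_nonpos (mem_of_superset (Ioo_mem_nhds hpx hxq) hwx)
      ((hvxx x hxm t htm).add (((hhx x t).const_mul (-α)).const_mul ε))
  have hwt : 0 ≤ vt x t + ε * (α * K * h x t) := by
    refine ((hvt x hxm t htm).add
      ((hht x t).hasDerivWithinAt.const_mul ε)).nonneg_of_eventually_le_left ?_
    filter_upwards [Ioo_mem_nhdsLT htt] with s hs using
      hw x hx s ⟨hs.1.le, hs.2.le.trans ht'.2⟩
  obtain ⟨hn₀, hnm⟩ := hn x hxm t htm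
  have haA := ha x hxm t htm
  have hbC := (abs_le.1 (hb x hxm t htm)).2
  have hLxt := hL x hxm t htm
  have h₁ := mul_nonneg hn₀ hwt
  have h₂ := mul_nonneg (hA.le.trans haA) (neg_nonneg.2 hwxx)
  have hcoef : n x t * K + b x t - a x t * α < 0 := by
    nlinarith [mul_le_mul_of_nonneg_right hnm hK.le, mul_le_mul_of_nonneg_right haA hα.le]
  have h₃ : ε * α * h x t * (n x t * K + b x t - a x t * α) < 0 :=
    mul_neg_of_pos_of_neg (mul_pos (mul_pos hε hα) (hc.trans hc_lt)) hcoef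
  have h₄ : b x t * (vx x t + ε * (-α * h x t)) = 0 := by rw [hwx_zero, mul_zero]
  nlinarith

/-- Propagation of an interior maximum along a time slice for the degenerate parabolic
    operator `(Lv)(x,t) = n0(x) vₜ - a(x,t) vₓₓ - b(x,t) vₓ`: if `Lv ≤ 0` on
    `(0,d0) × (0,T]` and `v` attains its maximum over `[0,d0] × [0,T]` at an interior
    point `(x0,t0) ∈ (0,d0) × (0,T]`, then `v(·,t0)` is constant on `(0,d0)`. -/
theorem interior_maximum_time_slice_degenerate_parabolic
    (B m d0 T : ℝ)
    (hB : 0 < B) (hm : 0 < m) (hd0 : d0 ∈ Set.Ioo (0:ℝ) 1) (hT : 0 < T)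
    (n0 : ℝ → ℝ) (hn0cont : Continuous n0)
    (hn0 : ∀ x ∈ Set.Icc (0:ℝ) d0, 0 ≤ n0 x ∧ n0 x ≤ m)
    (a b : ℝ → ℝ → ℝ)
    (hacont : ContinuousOn (fun p : ℝ × ℝ => a p.1 p.2) (Set.Icc 0 d0 ×ˢ Set.Icc 0 T))
    (hbcont : ContinuousOn (fun p : ℝ × ℝ => b p.1 p.2) (Set.Icc 0 d0 ×ˢ Set.Icc 0 T))
    (ha : ∀ x ∈ Set.Icc (0:ℝ) d0, ∀ t ∈ Set.Icc (0:ℝ) T,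
      1/(2*B) ≤ a x t ∧ a x t ≤ 2*B)
    (hb : ∀ x ∈ Set.Icc (0:ℝ) d0, ∀ t ∈ Set.Icc (0:ℝ) T, |b x t| ≤ 8*B*(m+1))
    (v vx vxx vt : ℝ → ℝ → ℝ)
    (hvx : ∀ x ∈ Set.Ioo (0:ℝ) d0, ∀ t ∈ Set.Ioc (0:ℝ) T,
      HasDerivAt (fun y => v y t) (vx x t) x)
    (hvxx : ∀ x ∈ Set.Ioo (0:ℝ) d0, ∀ t ∈ Set.Ioc (0:ℝ) T,
      HasDerivAt (fun y => vx y t) (vxx x t) x)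
    (hvt : ∀ x ∈ Set.Ioo (0:ℝ) d0, ∀ t ∈ Set.Ioc (0:ℝ) T,
      HasDerivWithinAt (fun s => v x s) (vt x t) (Set.Iic T) t)
    (hvxcont : ContinuousOn (fun p : ℝ × ℝ => vx p.1 p.2) (Set.Ioo 0 d0 ×ˢ Set.Ioc 0 T))
    (hvxxcont : ContinuousOn (fun p : ℝ × ℝ => vxx p.1 p.2) (Set.Ioo 0 d0 ×ˢ Set.Ioc 0 T))
    (hvtcont : ContinuousOn (fun p : ℝ × ℝ => vt p.1 p.2) (Set.Ioo 0 d0 ×ˢ Set.Ioc 0 T))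
    (hvcont : ContinuousOn (fun p : ℝ × ℝ => v p.1 p.2) (Set.Icc 0 d0 ×ˢ Set.Icc 0 T))
    (hLv : ∀ x ∈ Set.Ioo (0:ℝ) d0, ∀ t ∈ Set.Ioc (0:ℝ) T,
      n0 x * vt x t - a x t * vxx x t - b x t * vx x t ≤ 0)
    (x0 t0 : ℝ) (hx0 : x0 ∈ Set.Ioo (0:ℝ) d0) (ht0 : t0 ∈ Set.Ioc (0:ℝ) T)
    (hmax : ∀ x ∈ Set.Icc (0:ℝ) d0, ∀ t ∈ Set.Icc (0:ℝ) T, v x t ≤ v x0 t0) :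
    ∀ x ∈ Set.Ioo (0:ℝ) d0, v x t0 = v x0 t0 := by
  intro x₁ hx₁
  by_contra hne
  have hlt : v x₁ t0 < v x0 t0 :=
    (hmax x₁ (Ioo_subset_Icc_self hx₁) t0 (Ioc_subset_Icc_self ht0)).lt_of_ne hne
  obtain ⟨t₁, ht₁, hbelow⟩ : ∃ t₁ ∈ Ioo 0 t0, ∀ t ∈ Icc t₁ t0, v x₁ t < v x0 t0 := by
    have hcont : ContinuousWithinAt (fun t => v x₁ t) (Iic t0) t0 :=
      (hvt x₁ hx₁ t0 ht0).continuousWithinAt.mono (Iic_subset_Iic.2 ht0.2)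
    obtain ⟨l, hl, hsub⟩ := (mem_nhdsLE_iff_exists_Ioc_subset' ht0.1).1
      (hcont.eventually_lt_const hlt)
    obtain ⟨t₁, h₁, h₂⟩ := exists_between (max_lt ht0.1 hl)
    exact ⟨t₁, ⟨(le_max_left _ _).trans_lt h₁, h₂⟩, fun t ht =>
      hsub ⟨((le_max_right _ _).trans_lt h₁).trans_le ht.1, ht.2⟩⟩
  have hIoc : ∀ t ∈ Ioc t₁ t0, t ∈ Ioc 0 T := fun t ht =>
    ⟨ht₁.1.trans ht.1, ht.2.trans ht0.2⟩
  have hIcc : ∀ t ∈ Icc t₁ t0, t ∈ Icc 0 T := fun t ht =>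
    ⟨ht₁.1.le.trans ht.1, ht.2.trans ht0.2⟩
  have hA : 0 < 1 / (2 * B) := by positivity
  have hC : 0 ≤ 8 * B * (m + 1) := by positivity
  rcases lt_trichotomy x₁ x0 with hx | hx | hx
  · have hIoo : ∀ x ∈ Ioo x₁ d0, x ∈ Ioo 0 d0 := fun x hx => ⟨hx₁.1.trans hx.1, hx.2⟩
    have hIcc' : ∀ x ∈ Icc x₁ d0, x ∈ Icc 0 d0 := fun x hx => ⟨hx₁.1.le.trans hx.1, hx.2⟩
    refine lt_irrefl _ (degenerate_parabolic_lt_of_lt_left (n := fun x _ => n0 x)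
      hA hC hm.le ht₁.2
      (fun x hx t _ => hn0 x (Ioo_subset_Icc_self (hIoo x hx)))
      (fun x hx t ht =>
        (ha x (Ioo_subset_Icc_self (hIoo x hx)) t (Ioc_subset_Icc_self (hIoc t ht))).1)
      (fun x hx t ht => hb x (Ioo_subset_Icc_self (hIoo x hx)) t (Ioc_subset_Icc_self (hIoc t ht)))
      (fun x hx t ht => hvx x (hIoo x hx) t (hIoc t ht))
      (fun x hx t ht => hvxx x (hIoo x hx) t (hIoc t ht))
      (fun x hx t ht => (hvt x (hIoo x hx) t (hIoc t ht)).mono (Iic_subset_Iic.2 (hIoc t ht).2))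
      (hvcont.mono (prod_mono hIcc' hIcc))
      (fun x hx t ht => hLv x (hIoo x hx) t (hIoc t ht))
      (fun x hx t ht => hmax x (hIcc' x hx) t (hIcc t ht))
      hbelow x0 ⟨hx.le, hx0.2⟩)
  · exact hne (by rw [hx])
  · have hIoo : ∀ x ∈ Ioo (-x₁) 0, -x ∈ Ioo 0 d0 := fun x hx =>
      ⟨by linarith [hx.2], by linarith [hx.1, hx₁.2]⟩
    have hIcc' : ∀ x ∈ Icc (-x₁) 0, -x ∈ Icc 0 d0 := fun x hx =>
      ⟨by linarith [hx.2], by linarith [hx.1, hx₁.2]⟩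
    have hreflect : ∀ {f : ℝ → ℝ} {f' x : ℝ}, HasDerivAt f f' (-x) →
        HasDerivAt (fun y => f (-y)) (-f') x := fun {f f' x} hf =>
      (hf.comp x (hasDerivAt_neg x)).congr_deriv (by ring)
    have hkey := degenerate_parabolic_lt_of_lt_left (p := -x₁) (q := 0) (M := v x0 t0)
      (n := fun x _ => n0 (-x)) (a := fun x t => a (-x) t) (b := fun x t => -b (-x) t)
      (v := fun x t => v (-x) t) (vx := fun x t => -vx (-x) t) (vxx := fun x t => vxx (-x) t)
      (vt := fun x t => vt (-x) t) hA hC hm.le ht₁.2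
      (fun x hx t _ => hn0 _ (Ioo_subset_Icc_self (hIoo x hx)))
      (fun x hx t ht =>
        (ha _ (Ioo_subset_Icc_self (hIoo x hx)) t (Ioc_subset_Icc_self (hIoc t ht))).1)
      (fun x hx t ht => by
        rw [abs_neg]
        exact hb _ (Ioo_subset_Icc_self (hIoo x hx)) t (Ioc_subset_Icc_self (hIoc t ht)))
      (fun x hx t ht => hreflect (hvx _ (hIoo x hx) t (hIoc t ht)))
      (fun x hx t ht =>
        (hreflect (hvxx _ (hIoo x hx) t (hIoc t ht))).neg.congr_deriv (neg_neg _))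
      (fun x hx t ht => (hvt _ (hIoo x hx) t (hIoc t ht)).mono (Iic_subset_Iic.2 (hIoc t ht).2))
      (hvcont.comp (f := fun z : ℝ × ℝ => (-z.1, z.2)) (by fun_prop)
        fun z hz => ⟨hIcc' _ hz.1, hIcc _ hz.2⟩)
      (fun x hx t ht => by
        have := hLv _ (hIoo x hx) t (hIoc t ht)
        linarith)
      (fun x hx t ht => hmax _ (hIcc' x hx) t (hIcc t ht))
      (by simpa using hbelow) (-x0) ⟨by linarith, by linarith [hx0.1]⟩
    simp at hkey
end

section
/- Non-existence of classical solutions when the Euler density vanishes near a boundary point of the common support (Theorem 1, case Ω₁ ⫋ Ω₂, Lagrangian formulation): Suppose there exist p0 > 0 and d0 ∈ (0,1) such that either (i) ρ0 = 0 on (0,d0), n0 > 0 on (0,d0), n0'(x)/n0(x) ≥ p0 for all x ∈ (0,d0], w0(d0) < 0, and w0(x) ≤ 0 for all x ∈ (0,d0]; or (ii) ρ0 = 0 on (1−d0,1), n0 > 0 on (1−d0,1), n0'(x)/n0(x) ≤ −p0 for all x ∈ [1−d0,1), w0(1−d0) > 0, and w0(x) ≥ 0 for all x ∈ [1−d0,1).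 Then for every T > 0 there exists no classical solution of the Lagrangian two-phase problem on [0,1] × [0,T]. -/
open Set MeasureTheory

/-- A classical solution `(v1, v2)` of the Lagrangian formulation of the two-phase
    (pressureless Euler)/(Navier–Stokes) problem on `[0,1] × [0,T]`, with adiabatic
    exponent `γ`, viscosity `μ`, initial densities `ρ0, n0` and initial velocities
    `u0, w0`. -/
def IsLagrangianSolution (γ : ℝ) (μ ρ0 n0 u0 w0 : ℝ → ℝ) (T : ℝ)
    (v1 v2 : ℝ → ℝ → ℝ) : Prop :=
  ∃ v1t v2t v1x v2x v1xx v2xx η1x η2x : ℝ → ℝ → ℝ,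
    -- the derivatives ∂ₜvᵢ, ∂ₓvᵢ, ∂ₓₓvᵢ exist on [0,1] × [0,T]
    (∀ x ∈ Set.Icc (0:ℝ) 1, ∀ t ∈ Set.Icc (0:ℝ) T,
      HasDerivWithinAt (fun s => v1 x s) (v1t x t) (Set.Icc 0 T) t ∧
      HasDerivWithinAt (fun s => v2 x s) (v2t x t) (Set.Icc 0 T) t ∧
      HasDerivWithinAt (fun y => v1 y t) (v1x x t) (Set.Icc 0 1) x ∧
      HasDerivWithinAt (fun y => v2 y t) (v2x x t) (Set.Icc 0 1) x ∧
      HasDerivWithinAt (fun y => v1x y t) (v1xx x t) (Set.Icc 0 1) x ∧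
      HasDerivWithinAt (fun y => v2x y t) (v2xx x t) (Set.Icc 0 1) x) ∧
    -- v1, v2 and all these derivatives are continuous on [0,1] × [0,T]
    ContinuousOn (fun p : ℝ × ℝ => v1 p.1 p.2) (Set.Icc 0 1 ×ˢ Set.Icc 0 T) ∧
    ContinuousOn (fun p : ℝ × ℝ => v2 p.1 p.2) (Set.Icc 0 1 ×ˢ Set.Icc 0 T) ∧
    ContinuousOn (fun p : ℝ × ℝ => v1t p.1 p.2) (Set.Icc 0 1 ×ˢ Set.Icc 0 T) ∧
    ContinuousOn (fun p : ℝ × ℝ => v2t p.1 p.2) (Set.Icc 0 1 ×ˢ Set.Icc 0 T) ∧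
    ContinuousOn (fun p : ℝ × ℝ => v1x p.1 p.2) (Set.Icc 0 1 ×ˢ Set.Icc 0 T) ∧
    ContinuousOn (fun p : ℝ × ℝ => v2x p.1 p.2) (Set.Icc 0 1 ×ˢ Set.Icc 0 T) ∧
    ContinuousOn (fun p : ℝ × ℝ => v1xx p.1 p.2) (Set.Icc 0 1 ×ˢ Set.Icc 0 T) ∧
    ContinuousOn (fun p : ℝ × ℝ => v2xx p.1 p.2) (Set.Icc 0 1 ×ˢ Set.Icc 0 T) ∧
    -- the flow maps ηᵢ(x,t) = x + ∫₀ᵗ vᵢ(x,s) ds have positive spatial derivatives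
    (∀ x ∈ Set.Icc (0:ℝ) 1, ∀ t ∈ Set.Icc (0:ℝ) T,
      HasDerivWithinAt (fun y => y + ∫ s in (0:ℝ)..t, v1 y s) (η1x x t) (Set.Icc 0 1) x ∧
      HasDerivWithinAt (fun y => y + ∫ s in (0:ℝ)..t, v2 y s) (η2x x t) (Set.Icc 0 1) x ∧
      0 < η1x x t ∧ 0 < η2x x t) ∧
    -- the momentum equations hold on (0,1) × (0,T]
    (∀ x ∈ Set.Ioo (0:ℝ) 1, ∀ t ∈ Set.Ioc (0:ℝ) T,
      ρ0 x * v1t x t = -(ρ0 x) * (v1 x t - v2 x t) ∧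
      ∃ Px Vx : ℝ,
        HasDerivWithinAt (fun y => n0 y ^ γ / (η2x y t) ^ γ) Px (Set.Icc 0 1) x ∧
        HasDerivWithinAt (fun y => μ (n0 y / η2x y t) * v2x y t / η2x y t) Vx
          (Set.Icc 0 1) x ∧
        n0 x * v2t x t + Px = Vx + ρ0 x * (η2x x t / η1x x t) * (v1 x t - v2 x t)) ∧
    -- boundary conditions
    (∀ t ∈ Set.Ioc (0:ℝ) T, v2 0 t = 0 ∧ v2 1 t = 0 ∧ v2x 0 t = 0 ∧ v2x 1 t = 0) ∧
    -- initial conditions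
    (∀ x ∈ Set.Icc (0:ℝ) 1, v1 x 0 = u0 x ∧ v2 x 0 = w0 x)

/-- At a maximum over a convex set the derivative along the set is nonpositive. -/
lemma mul_deriv_nonpos_of_isMaxOn {f : ℝ → ℝ} {f' x y : ℝ} {s : Set ℝ} (hs : Convex ℝ s)
    (hf : HasDerivWithinAt f f' s x) (hmax : IsMaxOn f s x) (hx : x ∈ s) (hy : y ∈ s) :
    (y - x) * f' ≤ 0 := by
  have h := hmax.localize.hasFDerivWithinAt_nonpos hf.hasFDerivWithinAt
    (sub_mem_posTangentConeAt_of_segment_subset (hs.segment_subset hx hy))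
  simpa using h

/-- Necessary second-order condition at a local maximum. -/
lemma second_deriv_nonpos_of_isLocalMax {f f' : ℝ → ℝ} {f'' x : ℝ}
    (hf : ∀ᶠ y in nhds x, HasDerivAt f (f' y) y) (hf' : HasDerivAt f' f'' x)
    (hmax : IsLocalMax f x) : f'' ≤ 0 := by
  by_contra! hpos
  have hderiv : deriv f =ᶠ[nhds x] f' := hf.mono fun y hy => hy.deriv
  have hsecond : deriv (deriv f) x = f'' := by rw [hderiv.deriv_eq, hf'.deriv]
  have hmin : IsLocalMin f x := isLocalMin_of_deriv_deriv_pos (hsecond ▸ hpos)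
    hmax.deriv_eq_zero hf.self_of_nhds.continuousAt
  have hconst : f =ᶠ[nhds x] fun _ => f x := by
    filter_upwards [hmin, hmax] with y h1 h2 using le_antisymm h2 h1
  have hzero : deriv (deriv f) x = 0 := by
    rw [hconst.deriv.deriv_eq]
    simp
  linarith

/-- A boundary point lemma of Hopf type for subsolutions of `n vₜ ≤ a vₓₓ + b vₓ`, where `n` may
degenerate. The solution is compared with a travelling exponential barrier. -/
lemma boundary_deriv_neg_of_subsolution {v vt vx vxx : ℝ → ℝ → ℝ} {d t₀ m a₀ K l : ℝ}
    (hd : 0 < d) (ht₀ : 0 < t₀) (hm : 0 ≤ m) (ha₀ : 0 < a₀) (hK : 0 ≤ K)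
    (hcont : ContinuousOn (fun p : ℝ × ℝ => v p.1 p.2) (Icc 0 d ×ˢ Icc 0 t₀))
    (hvt : ∀ x ∈ Ioo 0 d, ∀ t ∈ Ioc 0 t₀,
      HasDerivWithinAt (fun s => v x s) (vt x t) (Icc 0 t₀) t)
    (hvx : ∀ x ∈ Ioo 0 d, ∀ t ∈ Ioc 0 t₀, HasDerivAt (fun y => v y t) (vx x t) x)
    (hvxx : ∀ x ∈ Ioo 0 d, ∀ t ∈ Ioc 0 t₀, HasDerivAt (fun y => vx y t) (vxx x t) x)
    (hpde : ∀ x ∈ Ioo 0 d, ∀ t ∈ Ioc 0 t₀, ∃ n a b, 0 ≤ n ∧ n ≤ m ∧ a₀ ≤ a ∧ |b| ≤ K ∧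
      n * vt x t ≤ a * vxx x t + b * vx x t)
    (hleft : ∀ t ∈ Icc 0 t₀, v 0 t ≤ 0) (hinit : ∀ x ∈ Icc 0 d, v x 0 ≤ 0)
    (hright : ∀ t ∈ Icc 0 t₀, v d t < 0) (hzero : v 0 t₀ = 0)
    (hl : HasDerivWithinAt (fun x => v x t₀) l (Icc 0 d) 0) : l < 0 := by
  obtain ⟨δ, hδ, hright⟩ : ∃ δ > 0, ∀ t ∈ Icc 0 t₀, v d t ≤ -δ := by
    have hc : ContinuousOn (fun t => v d t) (Icc 0 t₀) :=
      hcont.comp (f := fun t : ℝ => (d, t)) (by fun_prop) fun t ht => ⟨⟨hd.le, le_rfl⟩, ht⟩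
    obtain ⟨s, hs, hmax⟩ := isCompact_Icc.exists_isMaxOn (nonempty_Icc.2 ht₀.le) hc
    exact ⟨-v d s, by linarith [hright s hs], fun t ht => by simpa using hmax ht⟩
  set σ := d / t₀ with hσdef
  have hσ : 0 < σ := by positivity
  have hσt₀ : σ * t₀ = d := by rw [hσdef]; field_simp
  set k := (m * σ + K + 1) / a₀ with hkdef
  have hk : 0 < k := by positivity
  have hka : k * a₀ = m * σ + K + 1 := by rw [hkdef]; field_simp
  set ε := δ / Real.exp (k * d) with hεdef
  have hε : 0 < ε := by positivity
  have hεd : ε * Real.exp (k * d) = δ := by rw [hεdef]; field_simp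
  let h : ℝ → ℝ → ℝ := fun x t => ε * (Real.exp (k * (x - d + σ * t)) - 1)
  have hσt : ∀ t ∈ Icc 0 t₀, σ * t ≤ d := fun t ht => by
    rw [← hσt₀]; exact mul_le_mul_of_nonneg_left ht.2 hσ.le
  have hnonpos : ∀ x t, x - d + σ * t ≤ 0 → h x t ≤ 0 := fun x t hxt => by
    have : Real.exp (k * (x - d + σ * t)) ≤ 1 :=
      Real.exp_le_one_iff.2 (mul_nonpos_of_nonneg_of_nonpos hk.le hxt)
    exact mul_nonpos_of_nonneg_of_nonpos hε.le (by linarith)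
  have hhx : ∀ y t, HasDerivAt (fun y => h y t)
      (ε * k * Real.exp (k * (y - d + σ * t))) y := fun y t => by
    have := (((((hasDerivAt_id' y).sub_const d).add_const (σ * t)).const_mul k).exp.sub_const
      1).const_mul ε
    exact this.congr_deriv (by ring)
  have hcomp : ∀ p ∈ Icc 0 d ×ˢ Icc 0 t₀, v p.1 p.2 + h p.1 p.2 ≤ 0 := by
    have hcw : ContinuousOn (fun p : ℝ × ℝ => v p.1 p.2 + h p.1 p.2) (Icc 0 d ×ˢ Icc 0 t₀) :=
      hcont.add (by fun_prop)
    obtain ⟨⟨x, t⟩, ⟨hx, ht⟩, hmax⟩ := (isCompact_Icc.prod isCompact_Icc).exists_isMaxOn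
      ((nonempty_Icc.2 hd.le).prod (nonempty_Icc.2 ht₀.le)) hcw
    dsimp only at hx ht
    suffices hle : v x t + h x t ≤ 0 from fun p hp => (hmax hp).trans hle
    by_contra! hpos
    have hx0 : x ≠ 0 := by
      rintro rfl
      linarith [hnonpos 0 t (by linarith [hσt t ht]), hleft t ht]
    have ht0 : t ≠ 0 := by
      rintro rfl
      linarith [hnonpos x 0 (by linarith [hx.2]), hinit x hx]
    have hxd : x ≠ d := by
      rintro rfl
      have h1 : ε * Real.exp (k * (x - x + σ * t)) ≤ ε * Real.exp (k * x) := by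
        gcongr
        linarith [hσt t ht]
      have h2 : h x t = ε * Real.exp (k * (x - x + σ * t)) - ε := by simp only [h]; ring
      linarith [hright t ht]
    have hx' : x ∈ Ioo 0 d := ⟨lt_of_le_of_ne hx.1 hx0.symm, lt_of_le_of_ne hx.2 hxd⟩
    have ht' : t ∈ Ioc 0 t₀ := ⟨lt_of_le_of_ne ht.1 ht0.symm, ht.2⟩
    set E := Real.exp (k * (x - d + σ * t))
    have hEpos : 0 < E := Real.exp_pos _
    have hht : HasDerivAt (fun s => h x s) (ε * k * σ * E) t := by
      have := (((((hasDerivAt_id' t).const_mul σ).const_add (x - d)).const_mul k).exp.sub_const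
        1).const_mul ε
      exact this.congr_deriv (by ring)
    have hhxx : HasDerivAt (fun y => ε * k * Real.exp (k * (y - d + σ * t)))
        (ε * k * k * E) x := by
      have := ((((hasDerivAt_id' x).sub_const d).add_const (σ * t)).const_mul k).exp.const_mul
        (ε * k)
      exact this.congr_deriv (by ring)
    have hwt : 0 ≤ vt x t + ε * k * σ * E := by
      have hmt : IsMaxOn (fun s => v x s + h x s) (Icc 0 t) t := fun s hs =>
        hmax (a := (x, s)) ⟨hx, hs.1, hs.2.trans ht.2⟩
      have := mul_deriv_nonpos_of_isMaxOn (convex_Icc 0 t)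
        (((hvt x hx' t ht').mono (Icc_subset_Icc_right ht.2)).add hht.hasDerivWithinAt) hmt
        ⟨ht.1, le_rfl⟩ ⟨le_rfl, ht.1⟩
      nlinarith [ht'.1]
    have hmx : IsLocalMax (fun y => v y t + h y t) x := by
      filter_upwards [Icc_mem_nhds hx'.1 hx'.2] with y hy using hmax (a := (y, t)) ⟨hy, ht⟩
    have hwx : vx x t + ε * k * E = 0 :=
      hmx.hasDerivAt_eq_zero ((hvx x hx' t ht').add (hhx x t))
    have hwxx : vxx x t + ε * k * k * E ≤ 0 := by
      refine second_deriv_nonpos_of_isLocalMax ?_ ((hvxx x hx' t ht').add hhxx) hmx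
      filter_upwards [Ioo_mem_nhds hx'.1 hx'.2] with y hy using (hvx y hy t ht').add (hhx y t)
    obtain ⟨n, a, b, hn, hnm, ha, hb, hineq⟩ := hpde x hx' t ht'
    have hvxeq : vx x t = -(ε * k * E) := by linarith
    rw [hvxeq] at hineq
    have h1 : n * (-(ε * k * σ * E)) ≤ n * vt x t :=
      mul_le_mul_of_nonneg_left (by linarith) hn
    have h2 : a * vxx x t ≤ a * (-(ε * k * k * E)) :=
      mul_le_mul_of_nonneg_left (by linarith) (ha₀.le.trans ha)
    have h3 : 0 ≤ (ε * k * E) * (n * σ - a * k - b) := by linarith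
    have h4 : 0 ≤ n * σ - a * k - b := nonneg_of_mul_nonneg_right h3 (by positivity)
    have h5 : n * σ ≤ m * σ := by gcongr
    have h6 : a₀ * k ≤ a * k := by gcongr
    linarith [(abs_le.1 hb).1]
  have hh0 : h 0 t₀ = 0 := by simp [h, hσt₀]
  have hmax : IsMaxOn (fun x => v x t₀ + h x t₀) (Icc 0 d) 0 := fun x hx => by
    simpa [hzero, hh0] using hcomp (x, t₀) ⟨hx, ht₀.le, le_rfl⟩
  have hhx0 : HasDerivAt (fun y => h y t₀) (ε * k) 0 :=
    (hhx 0 t₀).congr_deriv (by simp [hσt₀])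
  have := mul_deriv_nonpos_of_isMaxOn (convex_Icc 0 d) (hl.add hhx0.hasDerivWithinAt) hmax
    ⟨le_rfl, hd.le⟩ ⟨hd.le, le_rfl⟩
  have h7 : 0 < ε * k := by positivity
  by_contra! hl0
  nlinarith

/-- Differentiation under the integral sign for functions that are `C¹` in space on a closed
rectangle. -/
lemma hasDerivAt_integral_of_continuousOn_rectangle {f fx : ℝ → ℝ → ℝ} {T t x : ℝ}
    (hf : ContinuousOn (fun p : ℝ × ℝ => f p.1 p.2) (Icc 0 1 ×ˢ Icc 0 T))
    (hfx : ContinuousOn (fun p : ℝ × ℝ => fx p.1 p.2) (Icc 0 1 ×ˢ Icc 0 T))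
    (hderiv : ∀ y ∈ Icc (0 : ℝ) 1, ∀ s ∈ Icc 0 T,
      HasDerivWithinAt (fun z => f z s) (fx y s) (Icc 0 1) y)
    (hx : x ∈ Ioo (0 : ℝ) 1) (ht : t ∈ Icc 0 T) :
    HasDerivAt (fun y => ∫ s in (0 : ℝ)..t, f y s) (∫ s in (0 : ℝ)..t, fx x s) x := by
  have hslice : ∀ {g : ℝ → ℝ → ℝ},
      ContinuousOn (fun p : ℝ × ℝ => g p.1 p.2) (Icc 0 1 ×ˢ Icc 0 T) →
      ∀ y ∈ Icc (0 : ℝ) 1, IntervalIntegrable (g y) volume 0 t := fun {g} hg y hy => by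
    have hc : ContinuousOn (g y) (Icc 0 t) :=
      hg.comp (f := fun s : ℝ => (y, s)) (by fun_prop) fun s hs => ⟨hy, hs.1, hs.2.trans ht.2⟩
    exact hc.intervalIntegrable_of_Icc ht.1
  obtain ⟨C, hC⟩ := (isCompact_Icc.prod isCompact_Icc).exists_bound_of_continuousOn hfx
  have hmem : ∀ s ∈ Set.uIoc 0 t, s ∈ Icc 0 T := fun s hs => by
    rw [Set.uIoc_of_le ht.1] at hs
    exact ⟨hs.1.le, hs.2.trans ht.2⟩
  refine (intervalIntegral.hasDerivAt_integral_of_dominated_loc_of_deriv_le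
    (F := f) (F' := fx) (bound := fun _ => C) (s := Ioo 0 1)
    (Ioo_mem_nhds hx.1 hx.2) ?_ (hslice hf x (Ioo_subset_Icc_self hx))
    (hslice hfx x (Ioo_subset_Icc_self hx)).def'.aestronglyMeasurable ?_
    intervalIntegrable_const ?_).2
  · filter_upwards [Ioo_mem_nhds hx.1 hx.2] with y hy
    exact (hslice hf y (Ioo_subset_Icc_self hy)).def'.aestronglyMeasurable
  · exact Filter.Eventually.of_forall fun s hs y hy =>
      hC (y, s) ⟨Ioo_subset_Icc_self hy, hmem s hs⟩
  · exact Filter.Eventually.of_forall fun s hs y hy =>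
      (hderiv y (Ioo_subset_Icc_self hy) s (hmem s hs)).hasDerivAt (Icc_mem_nhds hy.1 hy.2)

/-- The spatial derivative of the flow map stays close to `1` for short times, and its own
spatial derivative stays small. -/
lemma flow_deriv_estimates {v vx vxx η : ℝ → ℝ → ℝ} {T : ℝ}
    (hv : ContinuousOn (fun p : ℝ × ℝ => v p.1 p.2) (Icc 0 1 ×ˢ Icc 0 T))
    (hvx : ContinuousOn (fun p : ℝ × ℝ => vx p.1 p.2) (Icc 0 1 ×ˢ Icc 0 T))
    (hvxx : ContinuousOn (fun p : ℝ × ℝ => vxx p.1 p.2) (Icc 0 1 ×ˢ Icc 0 T))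
    (hd : ∀ x ∈ Icc (0 : ℝ) 1, ∀ t ∈ Icc 0 T,
      HasDerivWithinAt (fun y => v y t) (vx x t) (Icc 0 1) x)
    (hdd : ∀ x ∈ Icc (0 : ℝ) 1, ∀ t ∈ Icc 0 T,
      HasDerivWithinAt (fun y => vx y t) (vxx x t) (Icc 0 1) x)
    (hη : ∀ x ∈ Icc (0 : ℝ) 1, ∀ t ∈ Icc 0 T,
      HasDerivWithinAt (fun y => y + ∫ s in (0 : ℝ)..t, v y s) (η x t) (Icc 0 1) x) :
    ∃ C, 0 ≤ C ∧ ∀ x ∈ Ioo (0 : ℝ) 1, ∀ t ∈ Icc 0 T, |η x t - 1| ≤ C * t ∧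
      ∃ e, HasDerivAt (fun y => η y t) e x ∧ |e| ≤ C * t := by
  obtain ⟨C₁, hC₁⟩ := (isCompact_Icc.prod isCompact_Icc).exists_bound_of_continuousOn hvx
  obtain ⟨C₂, hC₂⟩ := (isCompact_Icc.prod isCompact_Icc).exists_bound_of_continuousOn hvxx
  have hηeq : ∀ x ∈ Ioo (0 : ℝ) 1, ∀ t ∈ Icc 0 T, η x t = 1 + ∫ s in (0 : ℝ)..t, vx x s :=
    fun x hx t ht =>
      ((hη x (Ioo_subset_Icc_self hx) t ht).hasDerivAt (Icc_mem_nhds hx.1 hx.2)).unique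
        ((hasDerivAt_id' x).add
          (hasDerivAt_integral_of_continuousOn_rectangle hv hvx hd hx ht))
  have hbound : ∀ {g : ℝ → ℝ → ℝ} {D : ℝ},
      (∀ p ∈ Icc (0 : ℝ) 1 ×ˢ Icc 0 T, ‖g p.1 p.2‖ ≤ D) → D ≤ max 0 (max C₁ C₂) →
      ∀ x ∈ Ioo (0 : ℝ) 1, ∀ t ∈ Icc 0 T,
        |∫ s in (0 : ℝ)..t, g x s| ≤ max 0 (max C₁ C₂) * t := by
    intro g D hg hD x hx t ht
    have h := intervalIntegral.norm_integral_le_of_norm_le_const (f := g x) (a := 0) (b := t)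
      (C := max 0 (max C₁ C₂)) fun s hs => by
        rw [Set.uIoc_of_le ht.1] at hs
        exact (hg (x, s) ⟨Ioo_subset_Icc_self hx, hs.1.le, hs.2.trans ht.2⟩).trans hD
    rwa [sub_zero, abs_of_nonneg ht.1, Real.norm_eq_abs] at h
  refine ⟨max 0 (max C₁ C₂), le_max_left _ _, fun x hx t ht => ⟨?_, ∫ s in (0 : ℝ)..t, vxx x s, ?_, ?_⟩⟩
  · rw [hηeq x hx t ht, add_sub_cancel_left]
    exact hbound hC₁ (by simp) x hx t ht
  · refine ((hasDerivAt_integral_of_continuousOn_rectangle hvx hvxx hdd hx ht).const_add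
      1).congr_of_eventuallyEq ?_
    filter_upwards [Ioo_mem_nhds hx.1 hx.2] with y hy using hηeq y hy t ht
  · exact hbound hC₂ (by simp) x hx t ht

/-- Expansion of the pressure gradient in terms of the logarithmic slope of the density. -/
lemma pressure_deriv_eq {γ x n' η' P : ℝ} {n η : ℝ → ℝ} (hγ : 0 < γ) (hn : HasDerivAt n n' x)
    (hη : HasDerivAt η η' x) (hnpos : 0 < n x) (hηpos : 0 < η x)
    (hP : HasDerivAt (fun y => n y ^ γ / η y ^ γ) P x) :
    ∃ c, 0 ≤ c ∧ P = c * (n' * η x - n x * η') := by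
  have h := (hn.rpow_const (p := γ) (Or.inl hnpos.ne')).div
    (hη.rpow_const (p := γ) (Or.inl hηpos.ne')) (Real.rpow_pos_of_pos hηpos γ).ne'
  refine ⟨γ * n x ^ (γ - 1) * η x ^ (γ - 1) / (η x ^ γ) ^ 2, by positivity, ?_⟩
  rw [hP.unique h, Real.rpow_sub_one hnpos.ne', Real.rpow_sub_one hηpos.ne']
  field_simp

/-- Expansion of the viscous term, with bounds on the coefficients, when the flow is close to the
identity. -/
lemma viscosity_deriv_eq {B D m x n' η' u' V : ℝ} {μ μd n η u : ℝ → ℝ} (hB : 0 < B)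
    (hμ : ∀ s, HasDerivAt μ (μd s) s) (hμbd : ∀ s, B⁻¹ ≤ μ s ∧ μ s ≤ B)
    (hD : ∀ s ∈ Icc 0 (2 * m), |μd s| ≤ D) (hn : HasDerivAt n n' x) (hη : HasDerivAt η η' x)
    (hu : HasDerivAt u u' x) (hn0 : 0 ≤ n x) (hnm : n x ≤ m) (hn'm : |n'| ≤ m)
    (hη1 : |η x - 1| ≤ 1 / 2) (hη' : |η'| ≤ 1 / 2)
    (hV : HasDerivAt (fun y => μ (n y / η y) * u y / η y) V x) :
    ∃ a b, B⁻¹ / 2 ≤ a ∧ |b| ≤ 16 * D * m + 2 * B ∧ V = a * u' + b * u x := by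
  obtain ⟨hlo, hhi⟩ := abs_le.1 hη1
  have hηpos : 0 < η x := by linarith
  have hm : 0 ≤ m := hn0.trans hnm
  have hinv : (η x)⁻¹ ≤ 2 := by
    rw [inv_le_comm₀ hηpos two_pos]; linarith
  have hinv0 : 0 < (η x)⁻¹ := inv_pos.2 hηpos
  have hBinv : 0 < B⁻¹ := inv_pos.2 hB
  have hq := hn.div hη hηpos.ne'
  have h := (((hμ (n x / η x)).comp x hq).mul hu).div hη hηpos.ne'
  have hqmem : n x / η x ∈ Icc 0 (2 * m) := by
    refine ⟨by positivity, ?_⟩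
    rw [div_le_iff₀ hηpos]
    nlinarith
  have hDq := hD _ hqmem
  have hD0 : 0 ≤ D := (abs_nonneg _).trans hDq
  obtain ⟨hμlo, hμhi⟩ := hμbd (n x / η x)
  refine ⟨μ (n x / η x) / η x, μd (n x / η x) * (n' * η x - n x * η') * (η x)⁻¹ ^ 3 -
    μ (n x / η x) * η' * (η x)⁻¹ ^ 2, ?_, ?_, ?_⟩
  · rw [le_div_iff₀ hηpos]
    nlinarith
  · have h1 : |n' * η x - n x * η'| ≤ 2 * m := by
      calc |n' * η x - n x * η'| ≤ |n' * η x| + |n x * η'| := abs_sub _ _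
        _ = |n'| * η x + n x * |η'| := by
          rw [abs_mul, abs_mul, abs_of_pos hηpos, abs_of_nonneg hn0]
        _ ≤ m * (3 / 2) + m * (1 / 2) := by
          gcongr
          linarith
        _ = 2 * m := by ring
    calc _ ≤ |μd (n x / η x) * (n' * η x - n x * η') * (η x)⁻¹ ^ 3| +
          |μ (n x / η x) * η' * (η x)⁻¹ ^ 2| := abs_sub _ _
      _ = |μd (n x / η x)| * |n' * η x - n x * η'| * (η x)⁻¹ ^ 3 +
          μ (n x / η x) * |η'| * (η x)⁻¹ ^ 2 := by
        rw [abs_mul, abs_mul, abs_mul, abs_mul, abs_of_nonneg (pow_nonneg hinv0.le 3),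
          abs_of_nonneg (pow_nonneg hinv0.le 2), abs_of_nonneg (hBinv.le.trans hμlo)]
      _ ≤ D * (2 * m) * 2 ^ 3 + B * (1 / 2) * 2 ^ 2 := by gcongr
      _ = 16 * D * m + 2 * B := by ring
  · rw [hV.unique h]
    simp only [Function.comp_apply, Pi.mul_apply, Pi.div_apply]
    field_simp
    ring

/-- Short-time nondivergence form of the viscous and pressure terms: uniformly elliptic with
bounded drift, and the sign of the pressure gradient is that of the logarithmic slope of the
density. -/
lemma exists_short_time_nondivergence_form {γ B m p T : ℝ} {μ μd n nd : ℝ → ℝ}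
    {v vx vxx η : ℝ → ℝ → ℝ} (hγ : 0 < γ) (hB : 0 < B) (hm : 0 ≤ m) (hp : 0 < p) (hT : 0 < T)
    (hμ : ∀ s, HasDerivAt μ (μd s) s) (hμd : Continuous μd)
    (hμbd : ∀ s, B⁻¹ ≤ μ s ∧ μ s ≤ B)
    (hn : ∀ x ∈ Ioo (0 : ℝ) 1, HasDerivAt n (nd x) x)
    (hnm : ∀ x ∈ Ioo (0 : ℝ) 1, n x ≤ m ∧ |nd x| ≤ m)
    (hv : ContinuousOn (fun p : ℝ × ℝ => v p.1 p.2) (Icc 0 1 ×ˢ Icc 0 T))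
    (hvx : ContinuousOn (fun p : ℝ × ℝ => vx p.1 p.2) (Icc 0 1 ×ˢ Icc 0 T))
    (hvxx : ContinuousOn (fun p : ℝ × ℝ => vxx p.1 p.2) (Icc 0 1 ×ˢ Icc 0 T))
    (hd : ∀ x ∈ Icc (0 : ℝ) 1, ∀ t ∈ Icc 0 T,
      HasDerivWithinAt (fun y => v y t) (vx x t) (Icc 0 1) x)
    (hdd : ∀ x ∈ Icc (0 : ℝ) 1, ∀ t ∈ Icc 0 T,
      HasDerivWithinAt (fun y => vx y t) (vxx x t) (Icc 0 1) x)
    (hη : ∀ x ∈ Icc (0 : ℝ) 1, ∀ t ∈ Icc 0 T,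
      HasDerivWithinAt (fun y => y + ∫ s in (0 : ℝ)..t, v y s) (η x t) (Icc 0 1) x) :
    ∃ K t₁, 0 ≤ K ∧ 0 < t₁ ∧ t₁ ≤ T ∧ ∀ x ∈ Ioo (0 : ℝ) 1, ∀ t ∈ Ioc 0 t₁, 0 < n x →
      ∀ P V, HasDerivWithinAt (fun y => n y ^ γ / η y t ^ γ) P (Icc 0 1) x →
        HasDerivWithinAt (fun y => μ (n y / η y t) * vx y t / η y t) V (Icc 0 1) x →
        ∃ a b, B⁻¹ / 2 ≤ a ∧ |b| ≤ K ∧ V = a * vxx x t + b * vx x t ∧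
          (p ≤ nd x / n x → 0 ≤ P) ∧ (nd x / n x ≤ -p → P ≤ 0) := by
  obtain ⟨C, hC, hflow⟩ := flow_deriv_estimates hv hvx hvxx hd hdd hη
  obtain ⟨D, hD⟩ := (isCompact_Icc (a := 0) (b := 2 * m)).exists_bound_of_continuousOn
    hμd.continuousOn
  have hD0 : 0 ≤ D := (norm_nonneg _).trans (hD 0 ⟨le_rfl, by positivity⟩)
  refine ⟨16 * D * m + 2 * B, min T (min (1 / 2) (p / 4) / (C + 1)), by positivity,
    lt_min hT (by positivity), min_le_left _ _, ?_⟩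
  intro x hx t ht hnx P V hP hV
  have htT : t ∈ Icc 0 T := ⟨ht.1.le, ht.2.trans (min_le_left _ _)⟩
  have hCt : C * t ≤ min (1 / 2) (p / 4) := by
    have h := ht.2.trans (min_le_right _ _)
    rw [le_div_iff₀ (by positivity)] at h
    linarith [ht.1]
  obtain ⟨hη1, e, he, heC⟩ := hflow x hx t htT
  have hhalf : C * t ≤ 1 / 2 := hCt.trans (min_le_left _ _)
  have hquarter : C * t ≤ p / 4 := hCt.trans (min_le_right _ _)
  have hηlo : 1 / 2 ≤ η x t := by linarith [(abs_le.1 hη1).1]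
  have hnhds : Icc (0 : ℝ) 1 ∈ nhds x := Icc_mem_nhds hx.1 hx.2
  obtain ⟨a, b, ha, hb, hVeq⟩ := viscosity_deriv_eq hB hμ hμbd hD (hn x hx) he
    ((hdd x (Ioo_subset_Icc_self hx) t htT).hasDerivAt hnhds) hnx.le (hnm x hx).1 (hnm x hx).2
    (hη1.trans hhalf) (heC.trans hhalf) (hV.hasDerivAt hnhds)
  obtain ⟨c, hc, rfl⟩ := pressure_deriv_eq hγ (hn x hx) he hnx (by linarith)
    (hP.hasDerivAt hnhds)
  obtain ⟨he1, he2⟩ := abs_le.1 (heC.trans hquarter)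
  have h1 : n x * p * (1 / 2) ≤ n x * p * η x t := by gcongr
  have h2 : n x * e ≤ n x * (p / 4) := by gcongr
  have h3 : n x * (-(p / 4)) ≤ n x * e := by gcongr
  have h4 : 0 < n x * p := by positivity
  refine ⟨a, b, ha, hb, hVeq, fun hslope => mul_nonneg hc ?_,
    fun hslope => mul_nonpos_of_nonneg_of_nonpos hc ?_⟩
  · rw [le_div_iff₀ hnx] at hslope
    have : p * n x * η x t ≤ nd x * η x t := by gcongr
    linarith
  · rw [div_le_iff₀ hnx] at hslope
    have : nd x * η x t ≤ -p * n x * η x t := by gcongr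
    linarith

/-- A subsolution with nonpositive initial data, negative at the right end, cannot vanish to first
order on the left boundary for any positive length of time. -/
lemma not_subsolution_of_boundary_deriv_zero {v vt vx vxx : ℝ → ℝ → ℝ} {d T m a₀ K : ℝ}
    (hd : 0 < d) (hT : 0 < T) (hm : 0 ≤ m) (ha₀ : 0 < a₀) (hK : 0 ≤ K)
    (hcont : ContinuousOn (fun p : ℝ × ℝ => v p.1 p.2) (Icc 0 d ×ˢ Icc 0 T))
    (hvt : ∀ x ∈ Ioo 0 d, ∀ t ∈ Ioc 0 T,
      HasDerivWithinAt (fun s => v x s) (vt x t) (Icc 0 T) t)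
    (hvx : ∀ x ∈ Ioo 0 d, ∀ t ∈ Ioc 0 T, HasDerivAt (fun y => v y t) (vx x t) x)
    (hvxx : ∀ x ∈ Ioo 0 d, ∀ t ∈ Ioc 0 T, HasDerivAt (fun y => vx y t) (vxx x t) x)
    (hleft : ∀ t ∈ Ioc 0 T, v 0 t = 0) (hinit : ∀ x ∈ Ioc 0 d, v x 0 ≤ 0)
    (hright : v d 0 < 0)
    (hl : ∀ t ∈ Ioc 0 T, HasDerivWithinAt (fun x => v x t) 0 (Icc 0 d) 0)
    (hpde : ∀ x ∈ Ioo 0 d, ∀ t ∈ Ioc 0 T, ∃ n a b, 0 ≤ n ∧ n ≤ m ∧ a₀ ≤ a ∧ |b| ≤ K ∧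
      n * vt x t ≤ a * vxx x t + b * vx x t) : False := by
  have hcorner : v 0 0 ≤ 0 := by
    have hc : ContinuousWithinAt (fun x => v x 0) (Icc 0 d) 0 :=
      (hcont.comp (f := fun x : ℝ => (x, (0 : ℝ))) (by fun_prop)
        fun x hx => ⟨hx, le_rfl, hT.le⟩) 0 ⟨le_rfl, hd.le⟩
    have : (nhdsWithin 0 (Ioc 0 d)).NeBot := left_nhdsWithin_Ioc_neBot hd
    exact le_of_tendsto (hc.mono Ioc_subset_Icc_self)
      (Filter.eventually_of_mem self_mem_nhdsWithin hinit)
  obtain ⟨r, hr, hneg⟩ : ∃ r > 0, ∀ t ∈ Icc 0 T, t < r → v d t < 0 := by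
    have hc : ContinuousWithinAt (fun t => v d t) (Icc 0 T) 0 :=
      (hcont.comp (f := fun t : ℝ => (d, t)) (by fun_prop)
        fun t ht => ⟨⟨hd.le, le_rfl⟩, ht⟩) 0 ⟨le_rfl, hT.le⟩
    obtain ⟨r, hr, h⟩ := Metric.mem_nhdsWithin_iff.1 (hc.eventually (gt_mem_nhds hright))
    refine ⟨r, hr, fun t ht htr => h ⟨?_, ht⟩⟩
    rwa [Metric.mem_ball, Real.dist_eq, sub_zero, abs_of_nonneg ht.1]
  set t₀ := min T (r / 2)
  have ht₀ : 0 < t₀ := lt_min hT (by positivity)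
  have hsub : t₀ ≤ T := min_le_left _ _
  have hIoc : ∀ t ∈ Ioc 0 t₀, t ∈ Ioc 0 T := fun t ht => ⟨ht.1, ht.2.trans hsub⟩
  refine lt_irrefl (0 : ℝ) (boundary_deriv_neg_of_subsolution (vt := vt) (vx := vx) (vxx := vxx)
    hd ht₀ hm ha₀ hK
    (hcont.mono (prod_mono le_rfl (Icc_subset_Icc_right hsub)))
    (fun x hx t ht => (hvt x hx t (hIoc t ht)).mono (Icc_subset_Icc_right hsub))
    (fun x hx t ht => hvx x hx t (hIoc t ht)) (fun x hx t ht => hvxx x hx t (hIoc t ht))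
    (fun x hx t ht => hpde x hx t (hIoc t ht)) ?_ ?_ ?_
    (hleft t₀ ⟨ht₀, hsub⟩) (hl t₀ ⟨ht₀, hsub⟩))
  · rintro t ⟨ht, htt⟩
    rcases ht.eq_or_lt with rfl | ht
    · exact hcorner
    · exact (hleft t ⟨ht, htt.trans hsub⟩).le
  · rintro x ⟨hx, hxd⟩
    rcases hx.eq_or_lt with rfl | hx
    · exact hcorner
    · exact hinit x ⟨hx, hxd⟩
  · intro t ht
    exact hneg t ⟨ht.1, ht.2.trans hsub⟩
      (by linarith [ht.2.trans (min_le_right T (r / 2))])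

/-- Theorem 1, case Ω₁ ⫋ Ω₂ (Lagrangian formulation): if near one end of the common
    support the Euler density `ρ0` vanishes while `n0 > 0` has a logarithmic slope
    bounded away from zero and `w0` has the indicated sign, then for every `T > 0` the
    Lagrangian two-phase problem admits no classical solution on `[0,1] × [0,T]`. -/
theorem nonexistence_classical_solution_euler_density_vanishes
    (γ B m M : ℝ) (hγ : 1 < γ) (hB : 0 < B) (hm : 0 < m) (hM : 0 < M)
    (μ μd ρ0 n0 u0 w0 : ℝ → ℝ)
    (hμ : ∀ s, HasDerivAt μ (μd s) s) (hμdcont : Continuous μd)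
    (hμbd : ∀ s, B⁻¹ ≤ μ s ∧ μ s ≤ B ∧ μd s ≤ B)
    (hρ0cont : Continuous ρ0) (hn0cont : Continuous n0)
    (hρ0nn : ∀ x, 0 ≤ ρ0 x) (hn0nn : ∀ x, 0 ≤ n0 x)
    (hρ0supp : ∀ x, x ∉ Set.Icc (0:ℝ) 1 → ρ0 x = 0)
    (hn0supp : ∀ x, x ∉ Set.Icc (0:ℝ) 1 → n0 x = 0)
    (n0d : ℝ → ℝ) (hn0d : ∀ x ∈ Set.Ioo (0:ℝ) 1, HasDerivAt n0 (n0d x) x)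
    (hn0dcont : ContinuousOn n0d (Set.Ioo 0 1))
    (u0d u0dd w0d w0dd : ℝ → ℝ)
    (hu0d : ∀ x, HasDerivAt u0 (u0d x) x) (hu0dd : ∀ x, HasDerivAt u0d (u0dd x) x)
    (hw0d : ∀ x, HasDerivAt w0 (w0d x) x) (hw0dd : ∀ x, HasDerivAt w0d (w0dd x) x)
    (hu0ddcont : Continuous u0dd) (hw0ddcont : Continuous w0dd)
    (hbound : ∀ x ∈ Set.Ioo (0:ℝ) 1,
      ρ0 x + n0 x + |n0d x| < m ∧
      |u0 x| < M ∧ |u0d x| < M ∧ |u0dd x| < M ∧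
      |w0 x| < M ∧ |w0d x| < M ∧ |w0dd x| < M)
    (p0 d0 : ℝ) (hp0 : 0 < p0) (hd0 : d0 ∈ Set.Ioo (0:ℝ) 1)
    (hcase :
      ((∀ x ∈ Set.Ioo (0:ℝ) d0, ρ0 x = 0 ∧ 0 < n0 x) ∧
       (∀ x ∈ Set.Ioc (0:ℝ) d0, p0 ≤ n0d x / n0 x) ∧
       w0 d0 < 0 ∧ (∀ x ∈ Set.Ioc (0:ℝ) d0, w0 x ≤ 0)) ∨
      ((∀ x ∈ Set.Ioo (1-d0) 1, ρ0 x = 0 ∧ 0 < n0 x) ∧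
       (∀ x ∈ Set.Ico (1-d0) 1, n0d x / n0 x ≤ -p0) ∧
       0 < w0 (1-d0) ∧ (∀ x ∈ Set.Ico (1-d0) 1, 0 ≤ w0 x))) :
    ∀ T > (0:ℝ), ¬ ∃ v1 v2 : ℝ → ℝ → ℝ, IsLagrangianSolution γ μ ρ0 n0 u0 w0 T v1 v2 := by
  rintro T hT ⟨v1, v2, v1t, v2t, v1x, v2x, v1xx, v2xx, η1x, η2x, hder, -, hcv, -, -, -, hcvx, -,
    hcvxx, hη, heq, hbc, hic⟩
  have hd : ∀ x ∈ Icc (0 : ℝ) 1, ∀ t ∈ Icc 0 T,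
      HasDerivWithinAt (fun y => v2 y t) (v2x x t) (Icc 0 1) x :=
    fun x hx t ht => (hder x hx t ht).2.2.2.1
  have hdd : ∀ x ∈ Icc (0 : ℝ) 1, ∀ t ∈ Icc 0 T,
      HasDerivWithinAt (fun y => v2x y t) (v2xx x t) (Icc 0 1) x :=
    fun x hx t ht => (hder x hx t ht).2.2.2.2.2
  have hnm : ∀ x ∈ Ioo (0 : ℝ) 1, n0 x ≤ m ∧ |n0d x| ≤ m := fun x hx => by
    have h := (hbound x hx).1
    constructor <;> linarith [hρ0nn x, hn0nn x, abs_nonneg (n0d x)]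
  obtain ⟨K, t₁, hK, ht₁, ht₁T, hform⟩ := exists_short_time_nondivergence_form
    (zero_lt_one.trans hγ) hB hm.le hp0 hT hμ hμdcont
    (fun s => ⟨(hμbd s).1, (hμbd s).2.1⟩) hn0d hnm hcv hcvx hcvxx hd hdd
    (fun x hx t ht => (hη x hx t ht).2.1)
  have hIoc : ∀ t ∈ Ioc 0 t₁, t ∈ Ioc 0 T := fun t ht => ⟨ht.1, ht.2.trans ht₁T⟩
  have hIcc : ∀ t ∈ Ioc 0 t₁, t ∈ Icc 0 T := fun t ht => Ioc_subset_Icc_self (hIoc t ht)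
  have hBinv : 0 < B⁻¹ / 2 := by positivity
  rcases hcase with ⟨hvac, hslope, hwd, hw⟩ | ⟨hvac, hslope, hwd, hw⟩
  · have hI : ∀ x ∈ Ioo 0 d0, x ∈ Ioo (0 : ℝ) 1 := fun x hx => ⟨hx.1, hx.2.trans hd0.2⟩
    have hnhds : ∀ x ∈ Ioo 0 d0, Icc (0 : ℝ) 1 ∈ nhds x := fun x hx =>
      Icc_mem_nhds hx.1 (hI x hx).2
    have hsub : Icc 0 d0 ⊆ Icc (0 : ℝ) 1 := Icc_subset_Icc_right hd0.2.le
    refine not_subsolution_of_boundary_deriv_zero (v := v2) (vt := v2t) (vx := v2x) (vxx := v2xx)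
      hd0.1 ht₁ hm.le hBinv hK
      (hcv.mono (prod_mono hsub (Icc_subset_Icc_right ht₁T)))
      (fun x hx t ht => ((hder x (Ioo_subset_Icc_self (hI x hx)) t (hIcc t ht)).2.1).mono
        (Icc_subset_Icc_right ht₁T))
      (fun x hx t ht =>
        (hd x (Ioo_subset_Icc_self (hI x hx)) t (hIcc t ht)).hasDerivAt (hnhds x hx))
      (fun x hx t ht =>
        (hdd x (Ioo_subset_Icc_self (hI x hx)) t (hIcc t ht)).hasDerivAt (hnhds x hx))
      (fun t ht => (hbc t (hIoc t ht)).1) ?_ ?_ ?_ ?_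
    · intro x hx
      rw [(hic x (hsub (Ioc_subset_Icc_self hx))).2]
      exact hw x hx
    · rwa [(hic d0 (Ioo_subset_Icc_self hd0)).2]
    · intro t ht
      exact ((hd 0 ⟨le_rfl, zero_le_one⟩ t (hIcc t ht)).congr_deriv
        (hbc t (hIoc t ht)).2.2.1).mono hsub
    · intro x hx t ht
      obtain ⟨-, P, V, hP, hV, hmom⟩ := heq x (hI x hx) t (hIoc t ht)
      obtain ⟨a, b, ha, hb, hVeq, hPpos, -⟩ :=
        hform x (hI x hx) t ht (hvac x hx).2 P V hP hV
      refine ⟨n0 x, a, b, hn0nn x, (hnm x (hI x hx)).1, ha, hb, ?_⟩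
      rw [(hvac x hx).1] at hmom
      linarith [hPpos (hslope x (Ioo_subset_Ioc_self hx))]
  · have hI : ∀ x ∈ Ioo 0 d0, 1 - x ∈ Ioo (1 - d0) 1 := fun x hx =>
      ⟨by linarith [hx.2], by linarith [hx.1]⟩
    have hI1 : ∀ x ∈ Ioo 0 d0, 1 - x ∈ Ioo (0 : ℝ) 1 := fun x hx =>
      ⟨by linarith [hx.2, hd0.2], (hI x hx).2⟩
    have hnhds : ∀ x ∈ Ioo 0 d0, Icc (0 : ℝ) 1 ∈ nhds (1 - x) := fun x hx =>
      Icc_mem_nhds (hI1 x hx).1 (hI1 x hx).2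
    have hmaps : MapsTo (fun x : ℝ => 1 - x) (Icc 0 d0) (Icc 0 1) := fun x hx =>
      ⟨by linarith [hx.2, hd0.2], by linarith [hx.1]⟩
    refine not_subsolution_of_boundary_deriv_zero (v := fun x t => -v2 (1 - x) t)
      (vt := fun x t => -v2t (1 - x) t) (vx := fun x t => v2x (1 - x) t)
      (vxx := fun x t => -v2xx (1 - x) t) hd0.1 ht₁ hm.le hBinv hK
      (hcv.comp (f := fun p : ℝ × ℝ => (1 - p.1, p.2)) (by fun_prop)
        fun p hp => ⟨hmaps hp.1, Icc_subset_Icc_right ht₁T hp.2⟩).neg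
      (fun x hx t ht => ((hder (1 - x) (Ioo_subset_Icc_self (hI1 x hx)) t
        (hIcc t ht)).2.1).neg.mono (Icc_subset_Icc_right ht₁T))
      (fun x hx t ht => ?_) (fun x hx t ht => ?_)
      (fun t ht => ?_) ?_ ?_ ?_ ?_
    · exact (((hd (1 - x) (Ioo_subset_Icc_self (hI1 x hx)) t (hIcc t ht)).hasDerivAt
        (hnhds x hx)).comp_const_sub 1 x).neg.congr_deriv (neg_neg _)
    · exact ((hdd (1 - x) (Ioo_subset_Icc_self (hI1 x hx)) t (hIcc t ht)).hasDerivAt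
        (hnhds x hx)).comp_const_sub 1 x
    · simp [(hbc t (hIoc t ht)).2.1]
    · intro x hx
      rw [(hic (1 - x) (hmaps (Ioc_subset_Icc_self hx))).2, neg_nonpos]
      exact hw (1 - x) ⟨by linarith [hx.2], by linarith [hx.1]⟩
    · rwa [(hic (1 - d0) (hmaps ⟨hd0.1.le, le_rfl⟩)).2, neg_lt_zero]
    · intro t ht
      have h := hd 1 ⟨zero_le_one, le_rfl⟩ t (hIcc t ht)
      rw [(hbc t (hIoc t ht)).2.2.2] at h
      rw [← sub_zero (1 : ℝ)] at h
      exact (h.comp 0 ((hasDerivAt_id' (0 : ℝ)).const_sub 1).hasDerivWithinAt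
        (by simpa using hmaps)).neg.congr_deriv (by simp)
    · intro x hx t ht
      obtain ⟨-, P, V, hP, hV, hmom⟩ := heq (1 - x) (hI1 x hx) t (hIoc t ht)
      obtain ⟨a, b, ha, hb, hVeq, -, hPneg⟩ :=
        hform (1 - x) (hI1 x hx) t ht (hvac _ (hI x hx)).2 P V hP hV
      refine ⟨n0 (1 - x), a, -b, hn0nn _, (hnm _ (hI1 x hx)).1, ha, by rwa [abs_neg], ?_⟩
      rw [(hvac _ (hI x hx)).1] at hmom
      linarith [hPneg (hslope _ (Ioo_subset_Ico_self (hI x hx)))]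
end
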